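/- Every finite-dimensional spectral COSEA E is isomorphic to a direct sum E_1⊕⋯⊕E_n of finitely many COSEAs, each of which is a factor. -/

import Mathlib

set_option linter.unusedVariables false

universe u v

theorem prod_eq' {α β : Type*} {p q : α × β} (h1 : p.1 = q.1) (h2 : p.2 = q.2) : p = q :=
  Prod.ext_iff.mpr ⟨h1, h2⟩

/-- A convex sequential effect algebra (COSEA).  The partial sum `⊕` is modelled by a
total operation `oplus` together with a definedness predicate `perp`; all axioms only
constrain `oplus` on pairs satisfying `perp`.  The scalar action is modelled by a total
map `smul : ℝ → E → E`, with axioms imposed for scalars in `[0,1]`. -/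
structure COSEA (E : Type u) where
  zero : E
  one : E
  perp : E → E → Prop
  oplus : E → E → E
  compl : E → E
  smul : ℝ → E → E
  seq : E → E → E
  -- effect algebra axioms
  perp_comm : ∀ a b, perp a b → perp b a
  oplus_comm : ∀ a b, perp a b → oplus a b = oplus b a
  perp_assoc_right : ∀ a b c, perp a b → perp (oplus a b) c → perp b c
  perp_assoc_left : ∀ a b c, perp a b → perp (oplus a b) c → perp a (oplus b c)
  oplus_assoc : ∀ a b c, perp a b → perp (oplus a b) c →
    oplus a (oplus b c) = oplus (oplus a b) c
  perp_compl : ∀ a, perp a (compl a)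
  oplus_compl : ∀ a, oplus a (compl a) = one
  compl_unique : ∀ a b, perp a b → oplus a b = one → b = compl a
  perp_one : ∀ a, perp a one → a = zero
  -- convexity axioms
  smul_smul : ∀ α β a, 0 ≤ α → α ≤ 1 → 0 ≤ β → β ≤ 1 →
    smul α (smul β a) = smul (α * β) a
  perp_smul_self : ∀ α β a, 0 ≤ α → 0 ≤ β → α + β ≤ 1 → perp (smul α a) (smul β a)
  add_smul : ∀ α β a, 0 ≤ α → 0 ≤ β → α + β ≤ 1 →
    smul (α + β) a = oplus (smul α a) (smul β a)
  perp_smul : ∀ lam a b, 0 ≤ lam → lam ≤ 1 → perp a b → perp (smul lam a) (smul lam b)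
  smul_oplus : ∀ lam a b, 0 ≤ lam → lam ≤ 1 → perp a b →
    smul lam (oplus a b) = oplus (smul lam a) (smul lam b)
  one_smul : ∀ a, smul 1 a = a
  -- sequential product axioms
  seq_perp : ∀ a b c, perp b c → perp (seq a b) (seq a c)
  seq_oplus : ∀ a b c, perp b c → seq a (oplus b c) = oplus (seq a b) (seq a c)
  one_seq : ∀ a, seq one a = a
  seq_eq_zero_comm : ∀ a b, seq a b = zero → seq b a = seq a b
  comm_compl : ∀ a b, seq a b = seq b a → seq a (compl b) = seq (compl b) a
  comm_assoc : ∀ a b c, seq a b = seq b a → seq a (seq b c) = seq (seq a b) c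
  comm_seq : ∀ a b c, seq c a = seq a c → seq c b = seq b c →
    seq c (seq a b) = seq (seq a b) c
  comm_oplus : ∀ a b c, seq c a = seq a c → seq c b = seq b c → perp a b →
    seq c (oplus a b) = seq (oplus a b) c
  smul_seq : ∀ lam a b, 0 ≤ lam → lam ≤ 1 → seq (smul lam a) b = smul lam (seq a b)
  seq_smul : ∀ lam a b, 0 ≤ lam → lam ≤ 1 → seq a (smul lam b) = smul lam (seq a b)

/-- `SumList C l s` : the orthogonal sum of the list `l` is defined and equals `s`. -/
inductive COSEA.SumList {E : Type u} (C : COSEA E) : List E → E → Prop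
  | nil : COSEA.SumList C [] C.zero
  | cons {a : E} {l : List E} {s : E} :
      COSEA.SumList C l s → C.perp a s → COSEA.SumList C (a :: l) (C.oplus a s)

namespace COSEA

variable {E : Type u}

/-- `a ≤ b` in the effect-algebra order. -/
def le (C : COSEA E) (a b : E) : Prop := ∃ c, C.perp a c ∧ C.oplus a c = b

/-- `a` is sharp: the greatest lower bound of `a` and `a'` is `0`,
i.e. every common lower bound of `a` and `a'` lies below `0`. -/
def IsSharp (C : COSEA E) (a : E) : Prop :=
  ∀ c, C.le c a → C.le c (C.compl a) → C.le c C.zero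

/-- `a` is a one-dimensional (atomic) sharp element. -/
def IsOneDim (C : COSEA E) (a : E) : Prop :=
  C.IsSharp a ∧ a ≠ C.zero ∧
    ∀ b, C.le b a → ∃ lam : ℝ, 0 ≤ lam ∧ lam ≤ 1 ∧ b = C.smul lam a

/-- A state on a COSEA. -/
def IsState (C : COSEA E) (ω : E → ℝ) : Prop :=
  (∀ a, 0 ≤ ω a ∧ ω a ≤ 1) ∧ ω C.one = 1 ∧
    ∀ a b, C.perp a b → ω (C.oplus a b) = ω a + ω b

/-- A context presented as an injective finite enumeration of one-dimensional
elements summing to `1`. -/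
def IsContextFun (C : COSEA E) {n : ℕ} (a : Fin n → E) : Prop :=
  Function.Injective a ∧ (∀ i, C.IsOneDim (a i)) ∧ C.SumList (List.ofFn a) C.one

/-- A context as a set of effects. -/
def IsContext (C : COSEA E) (A : Set E) : Prop :=
  ∃ (n : ℕ) (a : Fin n → E), C.IsContextFun a ∧ Set.range a = A

/-- `E` is finite-dimensional: there is no infinite sequence of one-dimensional
elements all of whose initial partial orthogonal sums are defined. -/
def FinDim (C : COSEA E) : Prop :=
  ¬ ∃ f : ℕ → E, (∀ i, C.IsOneDim (f i)) ∧
      ∀ n : ℕ, ∃ s, C.SumList ((List.range n).map f) s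

/-- `E` is state-unique. -/
def StateUnique (C : COSEA E) : Prop :=
  ∀ a, C.IsOneDim a → ∃! ω : E → ℝ, C.IsState ω ∧ ω a = 1

/-- `E` is symmetric : `â(b) = b̂(a)` for all one-dimensional `a, b`. -/
def Symm (C : COSEA E) : Prop :=
  ∀ a b ω ρ, C.IsOneDim a → C.IsOneDim b → C.IsState ω → C.IsState ρ →
    ω a = 1 → ρ b = 1 → ω b = ρ a

/-- `b = λ₁ a₁ ⊕ ⋯ ⊕ λₙ aₙ` with all `λ i ∈ [0,1]`. -/
def SpanRep (C : COSEA E) {n : ℕ} (a : Fin n → E) (lam : Fin n → ℝ) (b : E) : Prop :=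
  (∀ i, 0 ≤ lam i ∧ lam i ≤ 1) ∧
    C.SumList (List.ofFn fun i => C.smul (lam i) (a i)) b

/-- `b ∈ E(A)` : `b` has a representation over the context `A`. -/
def InSpan (C : COSEA E) (A : Set E) (b : E) : Prop :=
  ∃ (n : ℕ) (a : Fin n → E) (lam : Fin n → ℝ),
    C.IsContextFun a ∧ Set.range a = A ∧ C.SpanRep a lam b

/-- `E` is spectral. -/
def Spectral (C : COSEA E) : Prop :=
  C.StateUnique ∧ ∀ b, ∃ A, C.IsContext A ∧ C.InSpan A b

/-- The commutant of a subset. -/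
def commutant (C : COSEA E) (F : Set E) : Set E :=
  {b | ∀ a ∈ F, C.seq b a = C.seq a b}

/-- The center `E' = {b : b ∘ a = a ∘ b for all a}`. -/
def center (C : COSEA E) : Set E := C.commutant Set.univ

/-- `E` is a factor: the center consists of the effects `λ 1`, `λ ∈ [0,1]`. -/
def IsFactor (C : COSEA E) : Prop :=
  C.center = {b | ∃ lam : ℝ, 0 ≤ lam ∧ lam ≤ 1 ∧ b = C.smul lam C.one}

/-- Sub-COSEA. -/
def IsSubCOSEA (C : COSEA E) (F : Set E) : Prop :=
  C.zero ∈ F ∧ C.one ∈ F ∧ (∀ a ∈ F, C.compl a ∈ F) ∧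
    (∀ lam : ℝ, 0 ≤ lam → lam ≤ 1 → ∀ a ∈ F, C.smul lam a ∈ F) ∧
    (∀ a ∈ F, ∀ b ∈ F, C.perp a b → C.oplus a b ∈ F) ∧
    (∀ a ∈ F, ∀ b ∈ F, C.seq a b ∈ F)

/-- `a` is a minimal sharp element of `F`. -/
def MinSharp (C : COSEA E) (F : Set E) (a : E) : Prop :=
  a ∈ F ∧ C.IsSharp a ∧ a ≠ C.zero ∧
    ∀ b ∈ F, C.IsSharp b → b ≠ C.zero → C.le b a → b = a

/-- COSEA isomorphism. -/
def IsIso {F : Type u} (C : COSEA E) (D : COSEA F) (φ : E → F) : Prop :=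
  Function.Bijective φ ∧ φ C.one = D.one ∧
    (∀ a b, C.perp a b ↔ D.perp (φ a) (φ b)) ∧
    (∀ a b, C.perp a b → φ (C.oplus a b) = D.oplus (φ a) (φ b)) ∧
    (∀ lam : ℝ, 0 ≤ lam → lam ≤ 1 → ∀ a, φ (C.smul lam a) = D.smul lam (φ a)) ∧
    (∀ a b, φ (C.seq a b) = D.seq (φ a) (φ b))

/-- `lam` is an eigenvalue of `b` : `lam = â(b)` for some eigeneffect `a` of `b`. -/
def IsEigenvalue (C : COSEA E) (b : E) (lam : ℝ) : Prop :=
  ∃ (a : E) (ω : E → ℝ), C.IsOneDim a ∧ C.seq a b = C.seq b a ∧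
    C.IsState ω ∧ ω a = 1 ∧ lam = ω b

/-- The spectrum of `b`. -/
def spectrum (C : COSEA E) (b : E) : Set ℝ := {lam | C.IsEigenvalue b lam}

/-- `c = ⌈a⌉` : `c` is the least sharp element dominating `a`. -/
def IsCeil (C : COSEA E) (a c : E) : Prop :=
  C.IsSharp c ∧ C.le a c ∧ ∀ d, C.IsSharp d → C.le a d → C.le c d

/-- `b` is a pseudo-inverse of `a` with scalar `lam` :
`⌈b⌉ = ⌈a⌉`, `‖b‖ = 1` and `a ∘ b = b ∘ a = lam ⌈a⌉`. -/
def IsPseudoInvWith (C : COSEA E) (a b : E) (lam : ℝ) : Prop :=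
  (∃ ca, C.IsCeil a ca ∧ C.IsCeil b ca ∧
    C.seq a b = C.smul lam ca ∧ C.seq b a = C.smul lam ca) ∧
  IsGreatest (C.spectrum b) 1 ∧ 0 ≤ lam ∧ lam ≤ 1

/-- The conditional probability map `γ_a` (zero functionals are sent to `0`). -/
noncomputable def condProb (C : COSEA E) (a : E) (ω : E → ℝ) : E → ℝ :=
  fun c => if ω a = 0 then 0 else ω (C.seq a c) / ω a

/-- Membership in `Ω̂(E) = Ω(E) ∪ {0}`. -/
def InOmegaHat (C : COSEA E) (ω : E → ℝ) : Prop :=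
  C.IsState ω ∨ ω = fun _ => 0

/-- Direct sum of two COSEAs, with all operations componentwise. -/
def prod {E F : Type u} (C : COSEA E) (D : COSEA F) : COSEA (E × F) where
  zero := (C.zero, D.zero)
  one := (C.one, D.one)
  perp a b := C.perp a.1 b.1 ∧ D.perp a.2 b.2
  oplus a b := (C.oplus a.1 b.1, D.oplus a.2 b.2)
  compl a := (C.compl a.1, D.compl a.2)
  smul lam a := (C.smul lam a.1, D.smul lam a.2)
  seq a b := (C.seq a.1 b.1, D.seq a.2 b.2)
  perp_comm := fun a b h => ⟨C.perp_comm _ _ h.1, D.perp_comm _ _ h.2⟩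
  oplus_comm := fun a b h => prod_eq' (C.oplus_comm _ _ h.1) (D.oplus_comm _ _ h.2)
  perp_assoc_right := fun a b c h1 h2 =>
    ⟨C.perp_assoc_right _ _ _ h1.1 h2.1, D.perp_assoc_right _ _ _ h1.2 h2.2⟩
  perp_assoc_left := fun a b c h1 h2 =>
    ⟨C.perp_assoc_left _ _ _ h1.1 h2.1, D.perp_assoc_left _ _ _ h1.2 h2.2⟩
  oplus_assoc := fun a b c h1 h2 =>
    prod_eq' (C.oplus_assoc _ _ _ h1.1 h2.1) (D.oplus_assoc _ _ _ h1.2 h2.2)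
  perp_compl := fun a => ⟨C.perp_compl _, D.perp_compl _⟩
  oplus_compl := fun a => prod_eq' (C.oplus_compl _) (D.oplus_compl _)
  compl_unique := fun a b h he =>
    prod_eq' (C.compl_unique _ _ h.1 (congrArg Prod.fst he))
      (D.compl_unique _ _ h.2 (congrArg Prod.snd he))
  perp_one := fun a h => prod_eq' (C.perp_one _ h.1) (D.perp_one _ h.2)
  smul_smul := fun α β a h1 h2 h3 h4 =>
    prod_eq' (C.smul_smul _ _ _ h1 h2 h3 h4) (D.smul_smul _ _ _ h1 h2 h3 h4)
  perp_smul_self := fun α β a h1 h2 h3 =>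
    ⟨C.perp_smul_self _ _ _ h1 h2 h3, D.perp_smul_self _ _ _ h1 h2 h3⟩
  add_smul := fun α β a h1 h2 h3 =>
    prod_eq' (C.add_smul _ _ _ h1 h2 h3) (D.add_smul _ _ _ h1 h2 h3)
  perp_smul := fun lam a b h1 h2 h =>
    ⟨C.perp_smul _ _ _ h1 h2 h.1, D.perp_smul _ _ _ h1 h2 h.2⟩
  smul_oplus := fun lam a b h1 h2 h =>
    prod_eq' (C.smul_oplus _ _ _ h1 h2 h.1) (D.smul_oplus _ _ _ h1 h2 h.2)
  one_smul := fun a => prod_eq' (C.one_smul _) (D.one_smul _)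
  seq_perp := fun a b c h => ⟨C.seq_perp _ _ _ h.1, D.seq_perp _ _ _ h.2⟩
  seq_oplus := fun a b c h => prod_eq' (C.seq_oplus _ _ _ h.1) (D.seq_oplus _ _ _ h.2)
  one_seq := fun a => prod_eq' (C.one_seq _) (D.one_seq _)
  seq_eq_zero_comm := fun a b h =>
    prod_eq' (C.seq_eq_zero_comm _ _ (congrArg Prod.fst h))
      (D.seq_eq_zero_comm _ _ (congrArg Prod.snd h))
  comm_compl := fun a b h =>
    prod_eq' (C.comm_compl _ _ (congrArg Prod.fst h))
      (D.comm_compl _ _ (congrArg Prod.snd h))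
  comm_assoc := fun a b c h =>
    prod_eq' (C.comm_assoc _ _ _ (congrArg Prod.fst h))
      (D.comm_assoc _ _ _ (congrArg Prod.snd h))
  comm_seq := fun a b c h1 h2 =>
    prod_eq' (C.comm_seq _ _ _ (congrArg Prod.fst h1) (congrArg Prod.fst h2))
      (D.comm_seq _ _ _ (congrArg Prod.snd h1) (congrArg Prod.snd h2))
  comm_oplus := fun a b c h1 h2 hp =>
    prod_eq' (C.comm_oplus _ _ _ (congrArg Prod.fst h1) (congrArg Prod.fst h2) hp.1)
      (D.comm_oplus _ _ _ (congrArg Prod.snd h1) (congrArg Prod.snd h2) hp.2)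
  smul_seq := fun lam a b h1 h2 =>
    prod_eq' (C.smul_seq _ _ _ h1 h2) (D.smul_seq _ _ _ h1 h2)
  seq_smul := fun lam a b h1 h2 =>
    prod_eq' (C.seq_smul _ _ _ h1 h2) (D.seq_smul _ _ _ h1 h2)

/-- Direct sum of a family of COSEAs, with all operations componentwise. -/
def pi {ι : Type v} {E : ι → Type u} (C : ∀ i, COSEA (E i)) : COSEA (∀ i, E i) where
  zero := fun i => (C i).zero
  one := fun i => (C i).one
  perp a b := ∀ i, (C i).perp (a i) (b i)
  oplus a b := fun i => (C i).oplus (a i) (b i)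
  compl a := fun i => (C i).compl (a i)
  smul lam a := fun i => (C i).smul lam (a i)
  seq a b := fun i => (C i).seq (a i) (b i)
  perp_comm := fun a b h i => (C i).perp_comm _ _ (h i)
  oplus_comm := fun a b h => funext fun i => (C i).oplus_comm _ _ (h i)
  perp_assoc_right := fun a b c h1 h2 i => (C i).perp_assoc_right _ _ _ (h1 i) (h2 i)
  perp_assoc_left := fun a b c h1 h2 i => (C i).perp_assoc_left _ _ _ (h1 i) (h2 i)
  oplus_assoc := fun a b c h1 h2 => funext fun i => (C i).oplus_assoc _ _ _ (h1 i) (h2 i)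
  perp_compl := fun a i => (C i).perp_compl _
  oplus_compl := fun a => funext fun i => (C i).oplus_compl _
  compl_unique := fun a b h he =>
    funext fun i => (C i).compl_unique _ _ (h i) (congrFun he i)
  perp_one := fun a h => funext fun i => (C i).perp_one _ (h i)
  smul_smul := fun α β a h1 h2 h3 h4 =>
    funext fun i => (C i).smul_smul _ _ _ h1 h2 h3 h4
  perp_smul_self := fun α β a h1 h2 h3 i => (C i).perp_smul_self _ _ _ h1 h2 h3
  add_smul := fun α β a h1 h2 h3 => funext fun i => (C i).add_smul _ _ _ h1 h2 h3
  perp_smul := fun lam a b h1 h2 h i => (C i).perp_smul _ _ _ h1 h2 (h i)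
  smul_oplus := fun lam a b h1 h2 h =>
    funext fun i => (C i).smul_oplus _ _ _ h1 h2 (h i)
  one_smul := fun a => funext fun i => (C i).one_smul _
  seq_perp := fun a b c h i => (C i).seq_perp _ _ _ (h i)
  seq_oplus := fun a b c h => funext fun i => (C i).seq_oplus _ _ _ (h i)
  one_seq := fun a => funext fun i => (C i).one_seq _
  seq_eq_zero_comm := fun a b h =>
    funext fun i => (C i).seq_eq_zero_comm _ _ (congrFun h i)
  comm_compl := fun a b h => funext fun i => (C i).comm_compl _ _ (congrFun h i)
  comm_assoc := fun a b c h => funext fun i => (C i).comm_assoc _ _ _ (congrFun h i)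
  comm_seq := fun a b c h1 h2 =>
    funext fun i => (C i).comm_seq _ _ _ (congrFun h1 i) (congrFun h2 i)
  comm_oplus := fun a b c h1 h2 hp =>
    funext fun i => (C i).comm_oplus _ _ _ (congrFun h1 i) (congrFun h2 i) (hp i)
  smul_seq := fun lam a b h1 h2 => funext fun i => (C i).smul_seq _ _ _ h1 h2
  seq_smul := fun lam a b h1 h2 => funext fun i => (C i).seq_smul _ _ _ h1 h2

end COSEA

namespace COSEA

variable {E : Type u} (C : COSEA E)

section EffectAlgebra

theorem oplus_left_cancel {a b c : E} (hb : C.perp a b) (hc : C.perp a c)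
    (h : C.oplus a b = C.oplus a c) : b = c := by
  have key : ∀ x, C.perp a x → C.oplus a x = C.oplus a b →
      x = C.compl (C.oplus (C.compl (C.oplus a b)) a) := by
    intro x hx hxe
    have h0 : C.perp (C.oplus x a) (C.compl (C.oplus a b)) := by
      rw [← C.oplus_comm _ _ hx, hxe]
      exact C.perp_compl _
    have hxa := C.perp_comm _ _ hx
    have h1 := C.perp_assoc_left _ _ _ hxa h0
    have h2 := C.oplus_assoc _ _ _ hxa h0
    have h3 := C.perp_assoc_right _ _ _ hxa h0
    rw [C.oplus_comm _ _ h3] at h1 h2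
    refine C.compl_unique _ _ (C.perp_comm _ _ h1) ?_
    rw [C.oplus_comm _ _ (C.perp_comm _ _ h1), h2, ← C.oplus_comm _ _ hx, hxe, C.oplus_compl]
  rw [key b hb rfl, ← key c hc h.symm]

theorem compl_one : C.compl C.one = C.zero :=
  C.perp_one _ (C.perp_comm _ _ (C.perp_compl _))

theorem compl_compl (a : E) : C.compl (C.compl a) = a :=
  (C.compl_unique _ _ (C.perp_comm _ _ (C.perp_compl a)) (by
    rw [← C.oplus_comm _ _ (C.perp_compl a), C.oplus_compl])).symm

theorem perp_zero (a : E) : C.perp a C.zero := by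
  have h := C.perp_compl C.one
  rw [C.compl_one, ← C.oplus_compl a, C.oplus_comm _ _ (C.perp_compl a)] at h
  exact C.perp_assoc_right _ _ _ (C.perp_comm _ _ (C.perp_compl a)) h

theorem oplus_zero (a : E) : C.oplus a C.zero = a := by
  have hp := C.perp_comm _ _ (C.perp_compl a)
  have h := C.perp_zero C.one
  rw [← C.oplus_compl a, C.oplus_comm _ _ (C.perp_compl a)] at h
  have h1 := C.perp_assoc_left _ _ _ hp h
  have h2 := C.oplus_assoc _ _ _ hp h
  rw [← C.oplus_comm _ _ (C.perp_compl a), C.oplus_compl] at h2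
  have h3 := C.oplus_compl C.one
  rw [C.compl_one] at h3
  rw [C.compl_unique _ _ h1 (h2.trans h3), C.compl_compl]

theorem zero_oplus (a : E) : C.oplus C.zero a = a := by
  rw [← C.oplus_comm _ _ (C.perp_zero a), C.oplus_zero]

theorem eq_zero_of_oplus_eq_zero {a b : E} (h : C.perp a b) (h0 : C.oplus a b = C.zero) :
    a = C.zero := by
  have h1 := C.perp_comm _ _ (C.perp_zero C.one)
  rw [← h0, C.oplus_comm _ _ h] at h1
  exact C.perp_one _ (C.perp_assoc_right _ _ _ (C.perp_comm _ _ h) h1)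

theorem eq_zero_of_oplus_self {a b : E} (h : C.perp a b) (h0 : C.oplus a b = a) :
    b = C.zero :=
  C.oplus_left_cancel h (C.perp_zero a) (h0.trans (C.oplus_zero a).symm)

theorem assoc_symm {a b c : E} (hbc : C.perp b c) (h : C.perp a (C.oplus b c)) :
    C.perp a b ∧ C.perp (C.oplus a b) c ∧
      C.oplus a (C.oplus b c) = C.oplus (C.oplus a b) c := by
  have hcb := C.perp_comm _ _ hbc
  have h1 : C.perp (C.oplus c b) a := by
    rw [← C.oplus_comm _ _ hbc]; exact C.perp_comm _ _ h
  have hba := C.perp_assoc_right _ _ _ hcb h1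
  have hab := C.perp_comm _ _ hba
  have h2 := C.perp_assoc_left _ _ _ hcb h1
  rw [C.oplus_comm _ _ hba] at h2
  have h2' := C.perp_comm _ _ h2
  exact ⟨hab, h2', C.oplus_assoc _ _ _ hab h2'⟩

theorem le_refl (a : E) : C.le a a := ⟨C.zero, C.perp_zero a, C.oplus_zero a⟩

theorem eq_zero_of_le_zero {a : E} (h : C.le a C.zero) : a = C.zero := by
  obtain ⟨c, hc, h⟩ := h
  exact C.eq_zero_of_oplus_eq_zero hc h

theorem le_trans {a b c : E} (h : C.le a b) (h' : C.le b c) : C.le a c := by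
  obtain ⟨d, hd, rfl⟩ := h
  obtain ⟨e, he, rfl⟩ := h'
  exact ⟨C.oplus d e, C.perp_assoc_left _ _ _ hd he, C.oplus_assoc _ _ _ hd he⟩

theorem le_one (a : E) : C.le a C.one := ⟨_, C.perp_compl a, C.oplus_compl a⟩

theorem oplus_le_oplus_right {a b c : E} (h : C.le a b) (hb : C.perp b c) :
    C.perp a c ∧ C.le (C.oplus a c) (C.oplus b c) := by
  obtain ⟨d, hd, rfl⟩ := h
  rw [C.oplus_comm _ _ hd] at hb ⊢
  have hda := C.perp_comm _ _ hd
  have h1 := C.perp_assoc_left _ _ _ hda hb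
  refine ⟨C.perp_assoc_right _ _ _ hda hb, d, C.perp_comm _ _ h1, ?_⟩
  rw [← C.oplus_comm _ _ h1, C.oplus_assoc _ _ _ hda hb]

theorem oplus_le_oplus {a b c d : E} (h : C.le a b) (h' : C.le c d) (hb : C.perp b d) :
    C.perp a c ∧ C.le (C.oplus a c) (C.oplus b d) := by
  obtain ⟨h1, h2⟩ := C.oplus_le_oplus_right h hb
  obtain ⟨h3, h4⟩ := C.oplus_le_oplus_right h' (C.perp_comm _ _ h1)
  have h5 := C.perp_comm _ _ h3
  rw [C.oplus_comm _ _ h3, ← C.oplus_comm _ _ h1] at h4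
  exact ⟨h5, C.le_trans h4 h2⟩

theorem le_compl_of_perp {a b : E} (h : C.perp a b) : C.le a (C.compl b) := by
  have h0 : C.perp (C.oplus b a) (C.compl (C.oplus b a)) := C.perp_compl _
  have hba := C.perp_comm _ _ h
  refine ⟨C.compl (C.oplus b a), C.perp_assoc_right _ _ _ hba h0, ?_⟩
  refine C.compl_unique _ _ (C.perp_assoc_left _ _ _ hba h0) ?_
  rw [C.oplus_assoc _ _ _ hba h0, C.oplus_compl]

theorem oplus_oplus_oplus_comm {a b c d : E} (hab : C.perp a b) (hcd : C.perp c d)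
    (h : C.perp (C.oplus a b) (C.oplus c d)) :
    C.perp a c ∧ C.perp b d ∧ C.perp (C.oplus a c) (C.oplus b d) ∧
      C.oplus (C.oplus a b) (C.oplus c d) = C.oplus (C.oplus a c) (C.oplus b d) := by
  have hb := C.perp_assoc_right _ _ _ hab h
  have ha := C.perp_assoc_left _ _ _ hab h
  have e := C.oplus_assoc _ _ _ hab h
  have hdc := C.perp_comm _ _ hcd
  rw [C.oplus_comm _ _ hcd] at hb
  obtain ⟨hbd, hbdc, e'⟩ := C.assoc_symm hdc hb
  rw [C.oplus_comm _ _ hcd, e', C.oplus_comm _ _ hbdc] at ha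
  obtain ⟨hac, h1, e2⟩ := C.assoc_symm (C.perp_comm _ _ hbdc) ha
  refine ⟨hac, hbd, h1, ?_⟩
  rw [← e, ← e2, C.oplus_comm _ _ hcd, e', C.oplus_comm _ _ hbdc]

theorem oplus_perp_oplus_of_le {x₁ y₁ z₁ x₂ y₂ z₂ : E} (h₁ : C.perp x₁ y₁)
    (l₁ : C.le (C.oplus x₁ y₁) z₁) (h₂ : C.perp x₂ y₂) (l₂ : C.le (C.oplus x₂ y₂) z₂)
    (hz : C.perp z₁ z₂) :
    C.perp (C.oplus x₁ x₂) (C.oplus y₁ y₂) ∧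
      C.le (C.oplus (C.oplus x₁ x₂) (C.oplus y₁ y₂)) (C.oplus z₁ z₂) := by
  obtain ⟨h, hl⟩ := C.oplus_le_oplus l₁ l₂ hz
  obtain ⟨-, -, h', e⟩ := C.oplus_oplus_oplus_comm h₁ h₂ h
  exact ⟨h', e ▸ hl⟩

end EffectAlgebra

section Scalar

theorem zero_smul (a : E) : C.smul 0 a = C.zero := by
  have h := C.add_smul 0 0 a le_rfl le_rfl (by norm_num)
  rw [add_zero] at h
  exact C.eq_zero_of_oplus_self
    (C.perp_smul_self 0 0 a le_rfl le_rfl (by norm_num)) h.symm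

theorem smul_zero {r : ℝ} (h0 : 0 ≤ r) (h1 : r ≤ 1) : C.smul r C.zero = C.zero := by
  rw [← C.zero_smul C.zero, C.smul_smul _ _ _ h0 h1 le_rfl zero_le_one, mul_zero]

theorem eq_zero_of_smul_eq_zero {r : ℝ} (h0 : 0 < r) (h1 : r ≤ 1) {a : E}
    (h : C.smul r a = C.zero) : a = C.zero := by
  obtain ⟨n, hn⟩ := exists_nat_gt (1 / r)
  have hr : 0 < 1 / r := by positivity
  have hn0 : (0 : ℝ) < n := hr.trans hn
  have hnr : (1 : ℝ) / n ≤ r := by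
    rw [div_lt_iff₀ h0] at hn
    rw [div_le_iff₀ hn0]; linarith
  have hz : C.smul (1 / n) a = C.zero := by
    have hq0 : 0 ≤ (1 : ℝ) / n / r := by positivity
    have hq1 : (1 : ℝ) / n / r ≤ 1 := by rwa [div_le_one h0]
    rw [show (1 : ℝ) / n = 1 / n / r * r by field_simp, ← C.smul_smul _ _ _ hq0 hq1 h0.le h1, h,
      C.smul_zero hq0 hq1]
  have key : ∀ k : ℕ, k ≤ n → C.smul (k / n) a = C.zero := by
    intro k
    induction k with
    | zero => intro _; simp [C.zero_smul]
    | succ k ih =>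
      intro hk
      have hk' : ((k : ℝ) + 1) / n ≤ 1 := by
        rw [div_le_one hn0]; exact_mod_cast hk
      rw [Nat.cast_succ, add_div, C.add_smul _ _ _ (by positivity) (by positivity)
        (by rwa [← add_div]), ih (by omega), hz, C.oplus_zero]
  have := key n le_rfl
  rwa [div_self hn0.ne', C.one_smul] at this

theorem smul_injective {a : E} (ha : a ≠ C.zero) {r s : ℝ} (hr0 : 0 ≤ r) (hr1 : r ≤ 1)
    (hs0 : 0 ≤ s) (hs1 : s ≤ 1) (h : C.smul r a = C.smul s a) : r = s := by
  have key : ∀ r s : ℝ, 0 ≤ r → s ≤ 1 → C.smul r a = C.smul s a → ¬ r < s := by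
    intro r s hr hs h hlt
    have h1 := C.add_smul r (s - r) a hr (by linarith) (by linarith)
    rw [add_sub_cancel, ← h] at h1
    exact ha (C.eq_zero_of_smul_eq_zero (by linarith) (by linarith)
      (C.eq_zero_of_oplus_self
        (C.perp_smul_self r (s - r) a hr (by linarith) (by linarith)) h1.symm))
  exact le_antisymm (not_lt.1 (key s r hs0 hr1 h.symm)) (not_lt.1 (key r s hr0 hs1 h))

end Scalar

section Seq

theorem seq_zero (a : E) : C.seq a C.zero = C.zero := by
  have h := C.seq_oplus a _ _ (C.perp_zero C.zero)
  rw [C.oplus_zero] at h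
  exact C.eq_zero_of_oplus_self (C.seq_perp a _ _ (C.perp_zero _)) h.symm

theorem zero_seq (a : E) : C.seq C.zero a = C.zero := by
  rw [C.seq_eq_zero_comm _ _ (C.seq_zero a), C.seq_zero]

theorem seq_one (a : E) : C.seq a C.one = a := by
  have h := C.comm_compl a C.zero (by rw [C.zero_seq, C.seq_zero])
  rwa [← C.compl_one, C.compl_compl, C.one_seq] at h

theorem seq_mono (a : E) {b c : E} (h : C.le b c) : C.le (C.seq a b) (C.seq a c) := by
  obtain ⟨d, hd, rfl⟩ := h
  exact ⟨_, C.seq_perp a _ _ hd, (C.seq_oplus a _ _ hd).symm⟩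

theorem seq_le (a b : E) : C.le (C.seq a b) a := by
  simpa only [C.seq_one] using C.seq_mono a (C.le_one b)

theorem seq_compl_self {p : E} (h : C.seq p p = p) : C.seq p (C.compl p) = C.zero := by
  have h1 := C.seq_oplus p _ _ (C.perp_compl p)
  rw [C.oplus_compl, C.seq_one, h] at h1
  exact C.eq_zero_of_oplus_self (by simpa [h] using C.seq_perp p _ _ (C.perp_compl p)) h1.symm

end Seq

/-- A central element, with the quantifier of `center` unfolded. -/
def Central (b : E) : Prop := ∀ a, C.seq b a = C.seq a b

theorem mem_center_iff {b : E} : b ∈ C.center ↔ C.Central b :=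
  ⟨fun h a => h a trivial, fun h a _ => h a⟩

namespace Central

variable {C}

theorem one : C.Central C.one := fun a => by rw [C.one_seq, C.seq_one]

theorem compl {b : E} (h : C.Central b) : C.Central (C.compl b) :=
  fun a => (C.comm_compl a b (h a).symm).symm

theorem smul {b : E} (h : C.Central b) {r : ℝ} (h0 : 0 ≤ r) (h1 : r ≤ 1) :
    C.Central (C.smul r b) := fun a => by
  rw [C.smul_seq _ _ _ h0 h1, C.seq_smul _ _ _ h0 h1, h a]

theorem seq {b c : E} (hb : C.Central b) (hc : C.Central c) : C.Central (C.seq b c) :=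
  fun a => (C.comm_seq _ _ _ (hb a).symm (hc a).symm).symm

theorem oplus {b c : E} (hb : C.Central b) (hc : C.Central c) (h : C.perp b c) :
    C.Central (C.oplus b c) :=
  fun a => (C.comm_oplus _ _ _ (hb a).symm (hc a).symm h).symm

theorem seq_seq {b : E} (h : C.Central b) (c d : E) :
    C.seq b (C.seq c d) = C.seq (C.seq b c) d :=
  C.comm_assoc _ _ _ (h c)

theorem seq_le {b : E} (h : C.Central b) (a : E) : C.le (C.seq b a) a :=
  h a ▸ C.seq_le a b

theorem oplus_seq {b c : E} (hb : C.Central b) (hc : C.Central c) (h : C.perp b c) (a : E) :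
    C.seq (C.oplus b c) a = C.oplus (C.seq b a) (C.seq c a) := by
  rw [hb.oplus hc h a, C.seq_oplus _ _ _ h, hb a, hc a]

end Central

/-- A central idempotent. -/
structure CentralIdem (p : E) : Prop where
  central : C.Central p
  idem : C.seq p p = p

namespace CentralIdem

variable {C} {p : E}

theorem one : C.CentralIdem C.one := ⟨Central.one, C.one_seq _⟩

theorem seq_seq_self (hp : C.CentralIdem p) (x : E) : C.seq p (C.seq p x) = C.seq p x := by
  rw [hp.central.seq_seq, hp.idem]

theorem seq {q : E} (hp : C.CentralIdem p) (hq : C.CentralIdem q) :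
    C.CentralIdem (C.seq p q) := by
  refine ⟨hp.central.seq hq.central, ?_⟩
  rw [← hp.central.seq_seq, hq.central, ← hp.central.seq_seq, hq.idem, hp.seq_seq_self]

theorem compl (hp : C.CentralIdem p) : C.CentralIdem (C.compl p) := by
  refine ⟨hp.central.compl, ?_⟩
  have h := C.seq_oplus (C.compl p) _ _ (C.perp_compl p)
  rw [C.oplus_compl, C.seq_one, hp.central.compl p, C.seq_compl_self hp.idem,
    C.zero_oplus] at h
  exact h.symm

theorem le_of_fix {a : E} (h : C.seq p a = a) : C.le a p := h ▸ C.seq_le p a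

theorem seq_distrib (hp : C.CentralIdem p) (a b : E) :
    C.seq (C.seq p a) (C.seq p b) = C.seq p (C.seq a b) := by
  rw [← hp.central.seq_seq, C.comm_assoc a p b (hp.central a).symm, ← hp.central a,
    ← hp.central.seq_seq, hp.seq_seq_self]

end CentralIdem

/-- The corner cut out by `p`: the elements fixed by `p`. -/
abbrev Corner (p : E) : Type u := {b : E // C.seq p b = b}

section Corner

variable {C} {p : E}

/-- The projection onto the corner of a central idempotent. -/
def toCorner (hp : C.CentralIdem p) (x : E) : C.Corner p := ⟨C.seq p x, hp.seq_seq_self x⟩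

theorem corner_oplus (a b : C.Corner p) (h : C.perp a.1 b.1) :
    C.seq p (C.oplus a.1 b.1) = C.oplus a.1 b.1 := by
  rw [C.seq_oplus _ _ _ h, a.2, b.2]

theorem corner_smul (a : C.Corner p) {r : ℝ} (h0 : 0 ≤ r) (h1 : r ≤ 1) :
    C.seq p (C.smul r a.1) = C.smul r a.1 := by
  rw [C.seq_smul _ _ _ h0 h1, a.2]

theorem corner_seq (hp : C.CentralIdem p) (a : C.Corner p) (b : E) :
    C.seq p (C.seq a.1 b) = C.seq a.1 b := by
  rw [hp.central.seq_seq, a.2]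

theorem corner_perp_compl (hp : C.CentralIdem p) (a : C.Corner p) :
    C.perp a.1 (C.seq p (C.compl a.1)) := by
  obtain ⟨h, -⟩ := C.oplus_le_oplus (C.le_refl a.1) (hp.central.seq_le (C.compl a.1))
    (C.perp_compl _)
  exact h

theorem corner_oplus_compl (a : C.Corner p) :
    C.oplus a.1 (C.seq p (C.compl a.1)) = p := by
  have := C.seq_oplus p _ _ (C.perp_compl a.1)
  rw [C.oplus_compl, C.seq_one, a.2] at this
  exact this.symm

/-- The corner of a central idempotent `p` is a COSEA with unit `p`. -/
def corner (hp : C.CentralIdem p) : COSEA (C.Corner p) where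
  zero := ⟨C.zero, C.seq_zero p⟩
  one := ⟨p, hp.idem⟩
  perp a b := C.perp a.1 b.1
  oplus a b := toCorner hp (C.oplus a.1 b.1)
  compl a := toCorner hp (C.compl a.1)
  smul r a := toCorner hp (C.smul r a.1)
  seq a b := toCorner hp (C.seq a.1 b.1)
  perp_comm a b h := C.perp_comm _ _ h
  oplus_comm a b h := congrArg (toCorner hp) (C.oplus_comm _ _ h)
  perp_assoc_right a b c h h' := by
    simp only [toCorner, corner_oplus a b h] at h'
    exact C.perp_assoc_right _ _ _ h h'
  perp_assoc_left a b c h h' := by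
    simp only [toCorner, corner_oplus a b h] at h'
    simp only [toCorner, corner_oplus b c (C.perp_assoc_right _ _ _ h h')]
    exact C.perp_assoc_left _ _ _ h h'
  oplus_assoc a b c h h' := by
    simp only [toCorner, corner_oplus a b h] at h'
    simp only [toCorner, corner_oplus a b h, corner_oplus b c (C.perp_assoc_right _ _ _ h h'),
      C.oplus_assoc _ _ _ h h']
  perp_compl a := corner_perp_compl hp a
  oplus_compl a := Subtype.ext (by
    simp only [toCorner, corner_oplus_compl, hp.idem])
  compl_unique a b h h' := Subtype.ext (by
    have h1 := congrArg Subtype.val h'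
    simp only [toCorner, corner_oplus a b h] at h1
    exact C.oplus_left_cancel h (corner_perp_compl hp a)
      (h1.trans (corner_oplus_compl a).symm))
  perp_one a h := Subtype.ext (by
    refine C.eq_zero_of_le_zero ?_
    rw [← C.seq_compl_self hp.idem, ← a.2]
    exact C.seq_mono _ (C.le_compl_of_perp h))
  smul_smul r s a hr0 hr1 hs0 hs1 := by
    simp only [toCorner, corner_smul a hs0 hs1, C.smul_smul _ _ _ hr0 hr1 hs0 hs1]
  perp_smul_self r s a hr hs h := by
    simp only [toCorner, corner_smul a hr (by linarith), corner_smul a hs (by linarith)]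
    exact C.perp_smul_self _ _ _ hr hs h
  add_smul r s a hr hs h := by
    simp only [toCorner, corner_smul a hr (show r ≤ 1 by linarith),
      corner_smul a hs (show s ≤ 1 by linarith), C.add_smul _ _ _ hr hs h]
  perp_smul r a b h0 h1 h := by
    simp only [toCorner, corner_smul _ h0 h1]
    exact C.perp_smul _ _ _ h0 h1 h
  smul_oplus r a b h0 h1 h := by
    simp only [toCorner, corner_smul _ h0 h1, corner_oplus a b h, C.smul_oplus _ _ _ h0 h1 h]
  one_smul a := Subtype.ext (by simp only [toCorner, C.one_smul, a.2])
  seq_perp a b c h := by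
    simp only [toCorner, corner_seq hp]
    exact C.seq_perp _ _ _ h
  seq_oplus a b c h := by
    simp only [toCorner, corner_seq hp, corner_oplus b c h, C.seq_oplus _ _ _ h]
  one_seq a := Subtype.ext (by simp only [toCorner, a.2])
  seq_eq_zero_comm a b h := by
    have h1 := congrArg Subtype.val h
    simp only [toCorner, corner_seq hp] at h1
    simp only [toCorner, C.seq_eq_zero_comm _ _ h1]
  comm_compl a b h := by
    have h1 := congrArg Subtype.val h
    simp only [toCorner, corner_seq hp] at h1
    simp only [toCorner]
    rw [Subtype.mk.injEq, C.comm_seq p _ a.1 (hp.central _).symm (C.comm_compl _ _ h1)]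
  comm_assoc a b c h := by
    have h1 := congrArg Subtype.val h
    simp only [toCorner, corner_seq hp] at h1
    simp only [toCorner, corner_seq hp, C.comm_assoc _ _ _ h1]
  comm_seq a b c h h' := by
    have h1 := congrArg Subtype.val h
    have h2 := congrArg Subtype.val h'
    simp only [toCorner, corner_seq hp] at h1 h2
    simp only [toCorner, corner_seq hp, C.comm_seq _ _ _ h1 h2]
  comm_oplus a b c h h' hab := by
    have h1 := congrArg Subtype.val h
    have h2 := congrArg Subtype.val h'
    simp only [toCorner, corner_seq hp] at h1 h2
    simp only [toCorner, corner_oplus a b hab, C.comm_oplus _ _ _ h1 h2 hab]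
  smul_seq r a b h0 h1 := by
    simp only [toCorner, corner_seq hp, corner_smul _ h0 h1, C.smul_seq _ _ _ h0 h1]
  seq_smul r a b h0 h1 := by
    simp only [toCorner, corner_seq hp, corner_smul _ h0 h1, C.seq_smul _ _ _ h0 h1]

/-- A central element of a corner is central in the ambient COSEA. -/
theorem central_of_corner (hp : C.CentralIdem p) {b : C.Corner p}
    (hb : (corner hp).Central b) : C.Central b.1 := by
  intro c
  have h1 : C.seq b.1 (C.seq p c) = C.seq (C.seq p c) b.1 := by
    have h := congrArg Subtype.val (hb (toCorner hp c))
    simpa only [corner, toCorner, corner_seq hp b, corner_seq hp (toCorner hp c)] using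
      (corner_seq hp b _).symm.trans (h.trans (corner_seq hp (toCorner hp c) _))
  have h2 : C.seq b.1 (C.seq p c) = C.seq b.1 c := by
    rw [C.comm_assoc _ _ _ (hp.central b.1).symm, ← hp.central, b.2]
  rw [← h2, h1, hp.central c, ← C.comm_assoc _ _ _ (hp.central c).symm, b.2]

end Corner

namespace IsIso

variable {C}

theorem trans {F G : Type u} {D : COSEA F} {B : COSEA G} {φ : E → F} {ψ : F → G}
    (h : C.IsIso D φ) (h' : D.IsIso B ψ) : C.IsIso B (ψ ∘ φ) := by
  obtain ⟨h1, h2, h3, h4, h5, h6⟩ := h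
  obtain ⟨k1, k2, k3, k4, k5, k6⟩ := h'
  refine ⟨k1.comp h1, ?_, ?_, ?_, ?_, ?_⟩
  · simp [h2, k2]
  · intro a b; rw [h3, k3]; rfl
  · intro a b h
    simp [h4 a b h, k4 _ _ ((h3 a b).1 h)]
  · intro r h0 h1 a
    simp [h5 r h0 h1, k5 r h0 h1]
  · intro a b; simp [h6, k6]

end IsIso

theorem isIso_corner_one : C.IsIso (corner (CentralIdem.one (C := C)))
    (fun b => ⟨b, C.one_seq b⟩) := by
  refine ⟨⟨fun a b h => congrArg Subtype.val h, fun b => ⟨b.1, rfl⟩⟩, rfl,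
    fun a b => Iff.rfl, ?_, ?_, ?_⟩ <;> intros <;> apply Subtype.ext <;>
    simp [corner, toCorner, C.one_seq]

/-- A corner splits along an orthogonal decomposition of its unit. -/
theorem isIso_corner_prod {C : COSEA E} {p q r : E} (hp : C.CentralIdem p)
    (hq : C.CentralIdem q) (hr : C.CentralIdem r) (hqr : C.perp q r)
    (hs : C.oplus q r = p) :
    (corner hp).IsIso ((corner hq).prod (corner hr))
      (fun b => (toCorner hq b.1, toCorner hr b.1)) := by
  have hqr0 : C.seq q r = C.zero := by
    refine C.eq_zero_of_le_zero ?_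
    rw [← C.seq_compl_self hq.idem]
    exact C.seq_mono _ (C.le_compl_of_perp (C.perp_comm _ _ hqr))
  have hrq0 : C.seq r q = C.zero := by rw [hr.central, hqr0]
  have hqp : C.seq q p = q := by
    rw [← hs, C.seq_oplus _ _ _ hqr, hq.idem, hqr0, C.oplus_zero]
  have hrp : C.seq r p = r := by
    rw [← hs, C.seq_oplus _ _ _ hqr, hr.idem, hrq0, C.zero_oplus]
  have hqps : ∀ x, C.seq q (C.seq p x) = C.seq q x := fun x => by
    rw [hq.central.seq_seq, hqp]
  have hrps : ∀ x, C.seq r (C.seq p x) = C.seq r x := fun x => by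
    rw [hr.central.seq_seq, hrp]
  have hsplit : ∀ b : C.Corner p, C.oplus (C.seq q b.1) (C.seq r b.1) = b.1 := fun b => by
    rw [← hq.central.oplus_seq hr.central hqr, hs, b.2]
  refine ⟨⟨?_, ?_⟩, ?_, ?_, ?_, ?_, ?_⟩
  · intro a b h
    have h1 : C.seq q a.1 = C.seq q b.1 := congrArg (fun z => z.1.1) h
    have h2 : C.seq r a.1 = C.seq r b.1 := congrArg (fun z => z.2.1) h
    apply Subtype.ext
    rw [← hsplit a, ← hsplit b, h1, h2]
  · rintro ⟨x, y⟩
    have hxy : C.perp x.1 y.1 :=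
      (C.oplus_le_oplus (CentralIdem.le_of_fix x.2) (CentralIdem.le_of_fix y.2) hqr).1
    have hqy : C.seq q y.1 = C.zero := by
      rw [← y.2, hq.central.seq_seq, hqr0, C.zero_seq]
    have hrx : C.seq r x.1 = C.zero := by
      rw [← x.2, hr.central.seq_seq, hrq0, C.zero_seq]
    refine ⟨toCorner hp (C.oplus x.1 y.1), prod_eq' (Subtype.ext ?_) (Subtype.ext ?_)⟩
    · simp only [toCorner, hqps]
      rw [C.seq_oplus _ _ _ hxy, hqy, x.2, C.oplus_zero]
    · simp only [toCorner, hrps]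
      rw [C.seq_oplus _ _ _ hxy, hrx, y.2, C.zero_oplus]
  · exact prod_eq' (Subtype.ext hqp) (Subtype.ext hrp)
  · intro a b
    refine ⟨fun h => ⟨C.seq_perp _ _ _ h, C.seq_perp _ _ _ h⟩, fun h => ?_⟩
    have hq' := corner_oplus (toCorner hq a.1) (toCorner hq b.1) h.1
    have hr' := corner_oplus (toCorner hr a.1) (toCorner hr b.1) h.2
    have := (C.oplus_perp_oplus_of_le h.1 (CentralIdem.le_of_fix hq') h.2
      (CentralIdem.le_of_fix hr') hqr).1
    simp only [toCorner, hsplit] at this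
    exact this
  · intro a b h
    refine prod_eq' (Subtype.ext ?_) (Subtype.ext ?_)
    · simp only [corner, prod, toCorner, hqps, ← C.seq_oplus _ _ _ h, hq.seq_seq_self]
    · simp only [corner, prod, toCorner, hrps, ← C.seq_oplus _ _ _ h, hr.seq_seq_self]
  · intro t h0 h1 a
    refine prod_eq' (Subtype.ext ?_) (Subtype.ext ?_)
    · simp only [corner, prod, toCorner, hqps, ← C.seq_smul _ _ _ h0 h1, hq.seq_seq_self]
    · simp only [corner, prod, toCorner, hrps, ← C.seq_smul _ _ _ h0 h1, hr.seq_seq_self]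
  · intro a b
    refine prod_eq' (Subtype.ext ?_) (Subtype.ext ?_)
    · simp only [corner, prod, toCorner, hqps, hq.seq_distrib, hq.seq_seq_self]
    · simp only [corner, prod, toCorner, hrps, hr.seq_distrib, hr.seq_seq_self]

/-- `C` is isomorphic to a finite direct sum of factors. -/
def Decomposes : Prop :=
  ∃ (ι : Type) (_ : Finite ι) (F : ι → Type u) (D : ∀ i, COSEA (F i)) (φ : E → ∀ i, F i),
    C.IsIso (COSEA.pi D) φ ∧ ∀ i, (D i).IsFactor

namespace Decomposes

variable {C}

theorem of_isFactor (h : C.IsFactor) : C.Decomposes := by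
  refine ⟨Unit, inferInstance, fun _ => E, fun _ => C, fun b _ => b,
    ⟨⟨fun a b h => congrFun h (), fun f => ⟨f (), rfl⟩⟩, rfl,
      fun a b => ⟨fun h _ => h, fun h => h ()⟩, fun _ _ _ => rfl, fun _ _ _ _ => rfl,
      fun _ _ => rfl⟩, fun _ => h⟩

theorem of_isIso {F : Type u} {D : COSEA F} {φ : E → F} (h : C.IsIso D φ)
    (hD : D.Decomposes) : C.Decomposes := by
  obtain ⟨ι, hι, G, B, ψ, hψ, hB⟩ := hD
  exact ⟨ι, hι, G, B, _, h.trans hψ, hB⟩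

theorem prod {F : Type u} {D : COSEA F} (hC : C.Decomposes) (hD : D.Decomposes) :
    (C.prod D).Decomposes := by
  obtain ⟨ι, hι, G, B, φ, ⟨h1, h2, h3, h4, h5, h6⟩, hB⟩ := hC
  obtain ⟨κ, hκ, H, B', ψ, ⟨k1, k2, k3, k4, k5, k6⟩, hB'⟩ := hD
  refine ⟨ι ⊕ κ, inferInstance, Sum.elim G H,
    fun | .inl i => B i | .inr j => B' j,
    fun b => fun | .inl i => φ b.1 i | .inr j => ψ b.2 j,
    ⟨⟨?_, ?_⟩, ?_, ?_, ?_, ?_, ?_⟩, ?_⟩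
  · intro a b h
    refine prod_eq' (h1.1 (funext fun i => ?_)) (k1.1 (funext fun j => ?_))
    · exact congrFun h (.inl i)
    · exact congrFun h (.inr j)
  · intro f
    obtain ⟨a, ha⟩ := h1.2 fun i => f (.inl i)
    obtain ⟨b, hb⟩ := k1.2 fun j => f (.inr j)
    refine ⟨(a, b), funext fun i => ?_⟩
    rcases i with i | j
    · exact congrFun ha i
    · exact congrFun hb j
  · funext i
    rcases i with i | j
    · exact congrFun h2 i
    · exact congrFun k2 j
  · intro a b
    constructor
    · rintro ⟨h, h'⟩ (i | j)
      · exact (h3 _ _).1 h i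
      · exact (k3 _ _).1 h' j
    · intro h
      exact ⟨(h3 _ _).2 fun i => h (.inl i), (k3 _ _).2 fun j => h (.inr j)⟩
  · intro a b h
    funext i
    rcases i with i | j
    · exact congrFun (h4 _ _ h.1) i
    · exact congrFun (k4 _ _ h.2) j
  · intro r h0 h1 a
    funext i
    rcases i with i | j
    · exact congrFun (h5 r h0 h1 _) i
    · exact congrFun (k5 r h0 h1 _) j
  · intro a b
    funext i
    rcases i with i | j
    · exact congrFun (h6 _ _) i
    · exact congrFun (k6 _ _) j
  · rintro (i | j)
    · exact hB i
    · exact hB' j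

theorem exists_fin (h : C.Decomposes) :
    ∃ (n : ℕ) (Ei : Fin n → Type u) (Ci : ∀ i, COSEA (Ei i)) (φ : E → ∀ i, Ei i),
      C.IsIso (COSEA.pi Ci) φ ∧ ∀ i, (Ci i).IsFactor := by
  obtain ⟨ι, hι, G, B, φ, ⟨h1, h2, h3, h4, h5, h6⟩, hB⟩ := h
  obtain ⟨n, ⟨e⟩⟩ := Finite.exists_equiv_fin ι
  refine ⟨n, fun k => G (e.symm k), fun k => B (e.symm k), fun b k => φ b (e.symm k),
    ⟨?_, ?_, ?_, ?_, ?_, ?_⟩, fun k => hB _⟩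
  · exact (Equiv.piCongrLeft' G e).bijective.comp h1
  · exact funext fun k => congrFun h2 (e.symm k)
  · intro a b
    refine (h3 a b).trans ⟨fun h k => h (e.symm k), fun h i => ?_⟩
    obtain ⟨k, rfl⟩ := e.symm.surjective i
    exact h k
  · exact fun a b h => funext fun k => congrFun (h4 a b h) (e.symm k)
  · exact fun r h0 h1 a => funext fun k => congrFun (h5 r h0 h1 a) (e.symm k)
  · exact fun a b => funext fun k => congrFun (h6 a b) (e.symm k)

end Decomposes

end COSEA

section FunctionSpaces

variable {n : ℕ}

/-- A set of `[0,1]`-valued functions closed under the operations of an effect algebra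
with scalars and products. -/
structure IsEffectSet (K : Set (Fin n → ℝ)) : Prop where
  nonneg : ∀ f ∈ K, ∀ i, 0 ≤ f i
  le_one : ∀ f ∈ K, ∀ i, f i ≤ 1
  one_mem : 1 ∈ K
  compl_mem : ∀ f ∈ K, 1 - f ∈ K
  smul_mem : ∀ f ∈ K, ∀ r : ℝ, 0 ≤ r → r ≤ 1 → r • f ∈ K
  add_mem : ∀ f ∈ K, ∀ g ∈ K, (∀ i, f i + g i ≤ 1) → f + g ∈ K
  mul_mem : ∀ f ∈ K, ∀ g ∈ K, f * g ∈ K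

namespace IsEffectSet

variable {K : Set (Fin n → ℝ)}

/-- The functions of the form `r • g + s` with `g ∈ K`. -/
def affineHull (K : Set (Fin n → ℝ)) : Set (Fin n → ℝ) :=
  {f | ∃ r s : ℝ, ∃ g ∈ K, 0 < r ∧ ∀ i, f i = r * g i + s}

theorem affineHull_add (hK : IsEffectSet K) {f g : Fin n → ℝ} (hf : f ∈ affineHull K)
    (hg : g ∈ affineHull K) : f + g ∈ affineHull K := by
  obtain ⟨r, s, f', hf', hr, hf⟩ := hf
  obtain ⟨t, u, g', hg', ht, hg⟩ := hg
  have hrt : 0 < r + t := by positivity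
  have h1 : r / (r + t) ≤ 1 := by rw [div_le_one hrt]; linarith
  have h2 : t / (r + t) ≤ 1 := by rw [div_le_one hrt]; linarith
  refine ⟨r + t, s + u, (r / (r + t)) • f' + (t / (r + t)) • g', ?_, hrt, fun i => ?_⟩
  · refine hK.add_mem _ (hK.smul_mem _ hf' _ (by positivity) h1) _
      (hK.smul_mem _ hg' _ (by positivity) h2) fun i => ?_
    have e : r / (r + t) + t / (r + t) = 1 := by field_simp
    have := mul_le_mul_of_nonneg_left (hK.le_one _ hf' i) (show 0 ≤ r / (r + t) by positivity)
    have := mul_le_mul_of_nonneg_left (hK.le_one _ hg' i) (show 0 ≤ t / (r + t) by positivity)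
    simp only [Pi.smul_apply, smul_eq_mul]
    linarith
  · simp only [Pi.add_apply, Pi.smul_apply, smul_eq_mul, hf, hg]
    field_simp
    ring

theorem affineHull_const (hK : IsEffectSet K) (r : ℝ) :
    (fun _ => r) ∈ affineHull K :=
  ⟨1, r - 1, 1, hK.one_mem, one_pos, fun i => by simp⟩

theorem affineHull_smul (hK : IsEffectSet K) {f : Fin n → ℝ} (hf : f ∈ affineHull K) (t : ℝ) :
    t • f ∈ affineHull K := by
  obtain ⟨r, s, f', hf', hr, hf⟩ := hf
  rcases lt_trichotomy t 0 with ht | rfl | ht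
  · refine ⟨-t * r, t * r + t * s, 1 - f', hK.compl_mem _ hf', mul_pos (by linarith) hr, ?_⟩
    intro i
    simp only [Pi.smul_apply, smul_eq_mul, hf, Pi.sub_apply, Pi.one_apply]
    ring
  · rw [zero_smul]
    exact hK.affineHull_const 0
  · refine ⟨t * r, t * s, f', hf', mul_pos ht hr, fun i => ?_⟩
    simp only [Pi.smul_apply, smul_eq_mul, hf]
    ring

theorem affineHull_mul (hK : IsEffectSet K) {f g : Fin n → ℝ} (hf : f ∈ affineHull K)
    (hg : g ∈ affineHull K) : f * g ∈ affineHull K := by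
  obtain ⟨r, s, f', hf', hr, hf⟩ := hf
  obtain ⟨t, u, g', hg', ht, hg⟩ := hg
  have hsub : ∀ h ∈ K, h ∈ affineHull K := fun h hh => ⟨1, 0, h, hh, one_pos, by simp⟩
  have e : f * g = (r * t) • (f' * g') + ((r * u) • f' + ((s * t) • g' + fun _ => s * u)) := by
    funext i
    simp only [Pi.mul_apply, Pi.add_apply, Pi.smul_apply, smul_eq_mul, hf, hg]
    ring
  rw [e]
  exact hK.affineHull_add (hK.affineHull_smul (hsub _ (hK.mul_mem _ hf' _ hg')) _)
    (hK.affineHull_add (hK.affineHull_smul (hsub _ hf') _)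
      (hK.affineHull_add (hK.affineHull_smul (hsub _ hg') _) (hK.affineHull_const _)))

theorem mem_of_affineHull (hK : IsEffectSet K) {f : Fin n → ℝ} (hf : f ∈ affineHull K)
    (h0 : ∀ i, 0 ≤ f i) (h1 : ∀ i, f i ≤ 1) : f ∈ K := by
  obtain ⟨r, s, g, hg, hr, hf⟩ := hf
  obtain ⟨N, hN⟩ := exists_nat_gt (r + |s|)
  have hs := abs_nonneg s
  have hN0 : (0 : ℝ) < N := by linarith
  have hr1 : r / N ≤ 1 := by rw [div_le_one hN0]; linarith
  have hs1 : |s| / N ≤ 1 := by rw [div_le_one hN0]; linarith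
  have hN1 : (1 : ℝ) ≤ N := by
    exact_mod_cast Nat.one_le_iff_ne_zero.2 fun h => by simp [h] at hN0
  have hfN : ∀ i, (1 / (N : ℝ)) * f i ≤ 1 := fun i => by
    rw [one_div_mul_eq_div, div_le_one hN0]; exact (h1 i).trans hN1
  have hsmall : (1 / (N : ℝ)) • f ∈ K := by
    have hA := hK.smul_mem _ hg _ (show 0 ≤ r / N by positivity) hr1
    have hB := hK.smul_mem _ hK.one_mem _ (show 0 ≤ |s| / N by positivity) hs1
    rcases le_total 0 s with hs0 | hs0
    · have e : (1 / (N : ℝ)) • f = (r / (N : ℝ)) • g + (|s| / (N : ℝ)) • (1 : Fin n → ℝ) := by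
        funext i
        simp only [Pi.add_apply, Pi.smul_apply, smul_eq_mul, hf, abs_of_nonneg hs0, Pi.one_apply]
        ring
      have e' := e
      rw [e]
      refine hK.add_mem _ hA _ hB fun i => ?_
      have := congrFun e' i
      simp only [Pi.add_apply, Pi.smul_apply, smul_eq_mul] at this ⊢
      rw [← this]; exact hfN i
    · have e : (1 / (N : ℝ)) • f =
          1 - ((1 - (r / (N : ℝ)) • g) + (|s| / (N : ℝ)) • (1 : Fin n → ℝ)) := by
        funext i
        simp only [Pi.add_apply, Pi.sub_apply, Pi.smul_apply, smul_eq_mul, hf,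
          abs_of_nonpos hs0, Pi.one_apply]
        ring
      have e' := e
      rw [e]
      refine hK.compl_mem _ (hK.add_mem _ (hK.compl_mem _ hA) _ hB fun i => ?_)
      have := congrFun e' i
      have hpos : 0 ≤ (1 / (N : ℝ)) * f i := mul_nonneg (by positivity) (h0 i)
      simp only [Pi.add_apply, Pi.sub_apply, Pi.smul_apply, smul_eq_mul, Pi.one_apply] at this ⊢
      linarith
  have key : ∀ k : ℕ, k ≤ N → ((k : ℝ) / N) • f ∈ K := by
    intro k
    induction k with
    | zero =>
      intro _
      have := hK.smul_mem _ hK.one_mem 0 le_rfl zero_le_one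
      simpa using this
    | succ k ih =>
      intro hk
      rw [Nat.cast_succ, add_div, add_smul]
      refine hK.add_mem _ (ih (by omega)) _ hsmall fun i => ?_
      simp only [Pi.smul_apply, smul_eq_mul]
      rw [← add_mul, ← add_div]
      refine mul_le_one₀ ?_ (h0 i) (h1 i)
      rw [div_le_one hN0]; exact_mod_cast hk
  have := key N le_rfl
  rwa [div_self hN0.ne', one_smul] at this

/-- Level sets of members have their indicators in the set. -/
theorem levelSet_mem (hK : IsEffectSet K) {g : Fin n → ℝ} (hg : g ∈ K) (i : Fin n) :
    (fun k => if g k = g i then 1 else 0 : Fin n → ℝ) ∈ K := by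
  classical
  refine hK.mem_of_affineHull ?_ (fun k => by split_ifs <;> norm_num)
    (fun k => by split_ifs <;> norm_num)
  have e : (fun k => if g k = g i then 1 else 0 : Fin n → ℝ) =
      ∏ v ∈ (Finset.univ.image g).erase (g i),
        (1 / (g i - v)) • (g + fun _ => -v) := by
    funext k
    simp only [Finset.prod_apply, Pi.smul_apply, Pi.add_apply, smul_eq_mul]
    split_ifs with h
    · rw [Finset.prod_eq_one]
      intro v hv
      have : g i - v ≠ 0 := sub_ne_zero.2 (Finset.ne_of_mem_erase hv).symm
      rw [h]
      field_simp
      ring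
    · refine (Finset.prod_eq_zero (i := g k) (by simp [h]) ?_).symm
      ring
  rw [e]
  refine Finset.prod_induction _ (· ∈ affineHull K) (fun _ _ => hK.affineHull_mul)
    (hK.affineHull_const 1) fun v _ => ?_
  exact hK.affineHull_smul (hK.affineHull_add ⟨1, 0, g, hg, one_pos, by simp⟩
    (hK.affineHull_const _)) _

end IsEffectSet

end FunctionSpaces

namespace COSEA

variable {E : Type u} {C : COSEA E}

/-- Elements acting equally on all terms of an orthogonal sum act equally on the sum. -/
theorem SumList.seq_congr {b c : E} {l : List E} {s : E} (hl : C.SumList l s)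
    (h : ∀ x ∈ l, C.seq b x = C.seq c x) : C.seq b s = C.seq c s := by
  induction hl with
  | nil => rw [C.seq_zero, C.seq_zero]
  | cons _ hp ih =>
    simp only [List.mem_cons, forall_eq_or_imp] at h
    rw [C.seq_oplus _ _ _ hp, C.seq_oplus _ _ _ hp, h.1, ih h.2]

theorem SumList.seq_perp {b c : E} {l : List E} {s : E} (hl : C.SumList l s)
    (h : ∀ x ∈ l, C.perp (C.seq b x) (C.seq c x) ∧
      C.le (C.oplus (C.seq b x) (C.seq c x)) x) :
    C.perp (C.seq b s) (C.seq c s) ∧ C.le (C.oplus (C.seq b s) (C.seq c s)) s := by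
  induction hl with
  | nil =>
    rw [C.seq_zero, C.seq_zero, C.oplus_zero]
    exact ⟨C.perp_zero _, C.le_refl _⟩
  | cons _ hp ih =>
    simp only [List.mem_cons, forall_eq_or_imp] at h
    rw [C.seq_oplus _ _ _ hp, C.seq_oplus _ _ _ hp]
    exact C.oplus_perp_oplus_of_le h.1.1 h.1.2 (ih h.2).1 (ih h.2).2 hp

section Eigenvalues

variable {n : ℕ} {a : Fin n → E}

/-- The central element `b` acts on each `a i` as multiplication by `f i ∈ [0,1]`. -/
structure ActsBy (C : COSEA E) (a : Fin n → E) (b : E) (f : Fin n → ℝ) : Prop where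
  central : C.Central b
  nonneg : ∀ i, 0 ≤ f i
  le_one : ∀ i, f i ≤ 1
  seq_eq : ∀ i, C.seq b (a i) = C.smul (f i) (a i)

theorem Central.exists_actsBy {b : E} (hb : C.Central b) (ha : C.IsContextFun a) :
    ∃ f, C.ActsBy a b f := by
  choose f h0 h1 h using fun i => (ha.2.1 i).2.2 _ (hb.seq_le (a i))
  exact ⟨f, hb, h0, h1, h⟩

theorem ActsBy.eq_right {b : E} {f g : Fin n → ℝ} (ha : C.IsContextFun a)
    (hf : C.ActsBy a b f) (hg : C.ActsBy a b g) : f = g :=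
  funext fun i => C.smul_injective (ha.2.1 i).2.1 (hf.nonneg i) (hf.le_one i) (hg.nonneg i)
    (hg.le_one i) ((hf.seq_eq i).symm.trans (hg.seq_eq i))

theorem ActsBy.eq_left {b c : E} {f : Fin n → ℝ} (ha : C.IsContextFun a)
    (hb : C.ActsBy a b f) (hc : C.ActsBy a c f) : b = c := by
  have := ha.2.2.seq_congr (b := b) (c := c) (by
    intro x hx
    obtain ⟨i, rfl⟩ := (List.mem_ofFn' _ _).1 hx
    rw [hb.seq_eq, hc.seq_eq])
  rwa [C.seq_one, C.seq_one] at this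

theorem ActsBy.one : C.ActsBy a C.one 1 :=
  ⟨Central.one, fun _ => zero_le_one, fun _ => le_rfl, fun i => by
    rw [C.one_seq, Pi.one_apply, C.one_smul]⟩

theorem ActsBy.compl {b : E} {f : Fin n → ℝ} (h : C.ActsBy a b f) :
    C.ActsBy a (C.compl b) (1 - f) := by
  refine ⟨h.central.compl, fun i => sub_nonneg.2 (h.le_one i),
    fun i => sub_le_self _ (h.nonneg i), fun i => ?_⟩
  have h1 := h.central.oplus_seq h.central.compl (C.perp_compl b) (a i)
  have h2 := C.add_smul (f i) (1 - f i) (a i) (h.nonneg i) (sub_nonneg.2 (h.le_one i))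
    (by linarith)
  have hp := C.seq_perp (a i) _ _ (C.perp_compl b)
  rw [C.oplus_compl, C.one_seq, h.seq_eq] at h1
  rw [add_sub_cancel, C.one_smul] at h2
  rw [← h.central, ← h.central.compl, h.seq_eq] at hp
  exact C.oplus_left_cancel hp (C.perp_smul_self (f i) (1 - f i) _ (h.nonneg i)
    (sub_nonneg.2 (h.le_one i)) (by linarith)) (h1.symm.trans h2)

theorem ActsBy.smul {b : E} {f : Fin n → ℝ} (h : C.ActsBy a b f) {r : ℝ} (h0 : 0 ≤ r)
    (h1 : r ≤ 1) : C.ActsBy a (C.smul r b) (r • f) :=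
  ⟨h.central.smul h0 h1, fun i => mul_nonneg h0 (h.nonneg i),
    fun i => mul_le_one₀ h1 (h.nonneg i) (h.le_one i), fun i => by
      rw [C.smul_seq _ _ _ h0 h1, h.seq_eq, C.smul_smul _ _ _ h0 h1 (h.nonneg i) (h.le_one i)]
      rfl⟩

theorem ActsBy.mul {b c : E} {f g : Fin n → ℝ} (hb : C.ActsBy a b f) (hc : C.ActsBy a c g) :
    C.ActsBy a (C.seq b c) (f * g) :=
  ⟨hb.central.seq hc.central, fun i => mul_nonneg (hb.nonneg i) (hc.nonneg i),
    fun i => mul_le_one₀ (hb.le_one i) (hc.nonneg i) (hc.le_one i), fun i => by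
      rw [← hb.central.seq_seq, hc.seq_eq, C.seq_smul _ _ _ (hc.nonneg i) (hc.le_one i),
        hb.seq_eq, C.smul_smul _ _ _ (hc.nonneg i) (hc.le_one i) (hb.nonneg i) (hb.le_one i),
        mul_comm]
      rfl⟩

theorem ActsBy.add {b c : E} {f g : Fin n → ℝ} (ha : C.IsContextFun a)
    (hb : C.ActsBy a b f) (hc : C.ActsBy a c g) (h : ∀ i, f i + g i ≤ 1) :
    C.ActsBy a (C.oplus b c) (f + g) := by
  have hp : C.perp b c := by
    have := (ha.2.2.seq_perp (b := b) (c := c) (by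
      intro x hx
      obtain ⟨i, rfl⟩ := (List.mem_ofFn' _ _).1 hx
      rw [hb.seq_eq, hc.seq_eq, ← C.add_smul _ _ _ (hb.nonneg i) (hc.nonneg i) (h i)]
      refine ⟨C.perp_smul_self _ _ _ (hb.nonneg i) (hc.nonneg i) (h i), ?_⟩
      have h0 := add_nonneg (hb.nonneg i) (hc.nonneg i)
      have h1 := sub_nonneg.2 (h i)
      refine ⟨C.smul (1 - (f i + g i)) (a i), C.perp_smul_self _ _ _ h0 h1 (by linarith), ?_⟩
      rw [← C.add_smul _ _ _ h0 h1 (by linarith), add_sub_cancel, C.one_smul])).1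
    rwa [C.seq_one, C.seq_one] at this
  refine ⟨hb.central.oplus hc.central hp, fun i => add_nonneg (hb.nonneg i) (hc.nonneg i), h,
    fun i => ?_⟩
  rw [hb.central.oplus_seq hc.central hp, hb.seq_eq, hc.seq_eq, Pi.add_apply,
    C.add_smul _ _ _ (hb.nonneg i) (hc.nonneg i) (h i)]

theorem isEffectSet_actsBy (ha : C.IsContextFun a) :
    IsEffectSet {f | ∃ b, C.ActsBy a b f} where
  nonneg := fun _ ⟨_, h⟩ => h.nonneg
  le_one := fun _ ⟨_, h⟩ => h.le_one
  one_mem := ⟨_, ActsBy.one⟩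
  compl_mem := fun _ ⟨_, h⟩ => ⟨_, h.compl⟩
  smul_mem := fun _ ⟨_, h⟩ _ h0 h1 => ⟨_, h.smul h0 h1⟩
  add_mem := fun _ ⟨_, h⟩ _ ⟨_, h'⟩ hle => ⟨_, h.add ha h' hle⟩
  mul_mem := fun _ ⟨_, h⟩ _ ⟨_, h'⟩ => ⟨_, h.mul h'⟩

theorem CentralIdem.actsBy_eq_zero_or_one {p : E} (hp : C.CentralIdem p)
    (ha : C.IsContextFun a) {f : Fin n → ℝ} (hf : C.ActsBy a p f) (i : Fin n) :
    f i = 0 ∨ f i = 1 := by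
  have h := hf.mul hf
  rw [hp.idem] at h
  have e : f i * f i = f i := congrFun (h.eq_right ha hf) i
  rcases eq_or_ne (f i) 0 with h0 | h0
  · exact Or.inl h0
  · exact Or.inr (mul_right_cancel₀ h0 (e.trans (one_mul _).symm))

/-- A corner that is not a factor contains a proper central idempotent. -/
theorem exists_separating_idem {p : E} (hp : C.CentralIdem p) (ha : C.IsContextFun a)
    {f : Fin n → ℝ} (hf : C.ActsBy a p f) (hnf : ¬ (corner hp).IsFactor) :
    ∃ (q : E) (e : Fin n → ℝ) (i j : Fin n), C.CentralIdem q ∧ C.ActsBy a q e ∧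
      f i = 1 ∧ f j = 1 ∧ e i = 1 ∧ e j = 0 := by
  by_contra! hcon
  refine hnf (Set.Subset.antisymm ?_ ?_)
  · intro b hb
    have hb' := central_of_corner hp ((mem_center_iff _).1 hb)
    obtain ⟨g, hg⟩ := hb'.exists_actsBy ha
    have hfg : f * g = g := by
      have := hf.mul hg
      rw [b.2] at this
      exact this.eq_right ha hg
    have hconst : ∀ i j, f i = 1 → f j = 1 → g j = g i := by
      intro i j hi hj
      by_contra hne
      obtain ⟨q, hq⟩ := (isEffectSet_actsBy ha).levelSet_mem ⟨_, hg⟩ i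
      have hidem : C.seq q q = q := by
        have h2 := hq.mul hq
        refine ActsBy.eq_left ha (f := _) h2 ?_
        convert hq using 1
        funext k
        simp
      exact hcon q _ i j ⟨hq.central, hidem⟩ hq hi hj (by simp) (by simp [hne])
    have hscalar : ∃ r : ℝ, 0 ≤ r ∧ r ≤ 1 ∧ g = r • f := by
      by_cases hex : ∃ i, f i = 1
      · obtain ⟨i, hi⟩ := hex
        refine ⟨g i, hg.nonneg i, hg.le_one i, funext fun k => ?_⟩
        rcases hp.actsBy_eq_zero_or_one ha hf k with hk | hk
        · have := congrFun hfg k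
          simp only [Pi.mul_apply, hk, zero_mul] at this
          simp [hk, ← this]
        · simp [hk, hconst i k hi hk]
      · refine ⟨0, le_rfl, zero_le_one, funext fun k => ?_⟩
        have hk := (hp.actsBy_eq_zero_or_one ha hf k).resolve_right fun h => hex ⟨k, h⟩
        have := congrFun hfg k
        simp only [Pi.mul_apply, hk, zero_mul] at this
        simp [← this]
    obtain ⟨r, h0, h1, rfl⟩ := hscalar
    refine ⟨r, h0, h1, Subtype.ext ?_⟩
    have hbr : b.1 = C.smul r p := hg.eq_left ha (hf.smul h0 h1)
    simp only [corner, toCorner, C.seq_smul _ _ _ h0 h1, hp.idem, hbr]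
  · rintro b ⟨r, h0, h1, rfl⟩
    refine (mem_center_iff _).2 ?_
    refine Central.smul (Central.one) h0 h1

/-- Corners of central idempotents decompose into factors. -/
theorem corner_decomposes (ha : C.IsContextFun a) (m : ℕ) {p : E} (hp : C.CentralIdem p)
    {f : Fin n → ℝ} (hf : C.ActsBy a p f)
    (hm : (Finset.univ.filter fun i => f i = 1).card ≤ m) : (corner hp).Decomposes := by
  induction m generalizing p f with
  | zero =>
    by_contra hcon
    obtain ⟨q, e, i, j, -, -, hi, -⟩ :=
      exists_separating_idem hp ha hf fun h => hcon (.of_isFactor h)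
    rw [Nat.le_zero, Finset.card_eq_zero] at hm
    have : i ∈ Finset.univ.filter fun i => f i = 1 := by simp [hi]
    simp [hm] at this
  | succ m ih =>
    by_cases hfac : (corner hp).IsFactor
    · exact .of_isFactor hfac
    obtain ⟨q, e, i, j, hq, he, hi, hj, hei, hej⟩ := exists_separating_idem hp ha hf hfac
    have hpq := hf.mul he
    have hpq' := hf.mul he.compl
    have hperp := C.seq_perp p _ _ (C.perp_compl q)
    have hsum : C.oplus (C.seq p q) (C.seq p (C.compl q)) = p := by
      rw [← C.seq_oplus _ _ _ (C.perp_compl q), C.oplus_compl, C.seq_one]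
    refine Decomposes.of_isIso
      (isIso_corner_prod hp (hp.seq hq) (hp.seq hq.compl) hperp hsum)
      (Decomposes.prod (ih _ hpq ?_) (ih _ hpq' ?_))
    · refine Nat.lt_succ_iff.1 (lt_of_lt_of_le (Finset.card_lt_card ?_) hm)
      refine Finset.ssubset_iff_subset_ne.2 ⟨fun k hk => ?_, fun h => ?_⟩
      · rcases hp.actsBy_eq_zero_or_one ha hf k with h | h <;> simp_all
      · have : j ∈ Finset.univ.filter fun i => f i = 1 := by simp [hj]
        rw [← h] at this
        simp [hej] at this
    · refine Nat.lt_succ_iff.1 (lt_of_lt_of_le (Finset.card_lt_card ?_) hm)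
      refine Finset.ssubset_iff_subset_ne.2 ⟨fun k hk => ?_, fun h => ?_⟩
      · rcases hp.actsBy_eq_zero_or_one ha hf k with h | h <;> simp_all
      · have : i ∈ Finset.univ.filter fun i => f i = 1 := by simp [hi]
        rw [← h] at this
        simp [hei] at this

end Eigenvalues

end COSEA

/-- every finite-dimensional spectral COSEA is isomorphic to a
finite direct sum of factors. -/
theorem iso_direct_sum_of_factors {E : Type u} (C : COSEA E)
    (hFD : C.FinDim) (hSp : C.Spectral) :
    ∃ (n : ℕ) (Ei : Fin n → Type u) (Ci : ∀ i, COSEA (Ei i)) (φ : E → ∀ i, Ei i),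
      C.IsIso (COSEA.pi Ci) φ ∧ ∀ i, (Ci i).IsFactor := by
  obtain ⟨-, ⟨n, a, ha, -⟩, -⟩ := hSp.2 C.one
  exact (COSEA.Decomposes.of_isIso C.isIso_corner_one
    (COSEA.corner_decomposes ha _ COSEA.CentralIdem.one COSEA.ActsBy.one le_rfl)).exists_fin
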